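/- For every ε ≥ 0, every integer k with 1 ≤ k ≤ m, and any greedy-ε run W_0, …, W_k, one has cov(W_k) ≥ (opt(k) − εk) · (1 − (1 − 1/k)^k); moreover, if opt(k) ≥ εk, then cov(W_k) ≥ (opt(k) − εk) · (1 − 1/e). -/

import Mathlib

open Finset

/-- The coverage of a committee `W`: the number of voters `i` whose approval set
`A i` intersects `W`. -/
def cov {V C : Type*} [Fintype V] [DecidableEq C] (A : V → Finset C) (W : Finset C) : ℕ :=
  (Finset.univ.filter fun i => (A i ∩ W).Nonempty).card

theorem cov_mono {V C : Type*} [Fintype V] [DecidableEq C] (A : V → Finset C)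
    {W W' : Finset C} (h : W ⊆ W') : cov A W ≤ cov A W' :=
  card_le_card <| monotone_filter_right _ fun _ _ hi =>
    hi.mono (inter_subset_inter_left h)

/-- Submodularity of coverage, in the form used by greedy arguments. -/
theorem cov_le_cov_add_sum_gain {V C : Type*} [Fintype V] [DecidableEq C] (A : V → Finset C)
    (W O : Finset C) :
    (cov A O : ℝ) ≤ cov A W + ∑ x ∈ O, ((cov A (insert x W) : ℝ) - cov A W) := by
  classical
  let S : Finset C → Finset V := fun U => univ.filter fun i => (A i ∩ U).Nonempty
  have hS : ∀ x, S W ⊆ S (insert x W) := fun x =>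
    monotone_filter_right _ fun _ _ hi => hi.mono (inter_subset_inter_left (subset_insert x W))
  have hsub : S O ⊆ S W ∪ O.biUnion fun x => S (insert x W) \ S W := by
    intro i hi
    obtain ⟨x, hx⟩ := (mem_filter.1 hi).2
    rw [mem_inter] at hx
    by_cases hW : i ∈ S W
    · exact mem_union_left _ hW
    · refine mem_union_right _ (mem_biUnion.2 ⟨x, hx.2, mem_sdiff.2 ⟨?_, hW⟩⟩)
      exact mem_filter.2 ⟨mem_univ _, x, mem_inter.2 ⟨hx.1, mem_insert_self _ _⟩⟩
  have hcard : (S O).card ≤ (S W).card + ∑ x ∈ O, (S (insert x W) \ S W).card :=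
    (card_le_card hsub).trans <| (card_union_le _ _).trans <|
      Nat.add_le_add_left card_biUnion_le _
  have hgain : ∀ x, ((S (insert x W) \ S W).card : ℝ) = (cov A (insert x W) : ℝ) - cov A W :=
    fun x => cast_card_sdiff (hS x)
  calc (cov A O : ℝ) ≤ (S W).card + ∑ x ∈ O, ((S (insert x W) \ S W).card : ℝ) := by
        exact_mod_cast hcard
    _ = _ := by simp only [hgain]; rfl

/-- Any greedy-ε run `W 0, …, W k` (in each iteration the chosen candidate's
marginal gain falls short of the best available one by at most `ε`) satisfies
`cov (W k) ≥ (opt k - ε k) * (1 - (1 - 1/k)^k)`; moreover, when `opt k ≥ ε k`,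
`cov (W k) ≥ (opt k - ε k) * (1 - 1/e)`. -/
theorem greedy_eps_approximation
    {V C : Type*} [Fintype V] [Fintype C] [DecidableEq C]
    (A : V → Finset C) (ε : ℝ) (hε : 0 ≤ ε)
    (k : ℕ) (hk : 1 ≤ k) (hkm : k ≤ Fintype.card C)
    (W : ℕ → Finset C) (c : ℕ → C)
    (hW0 : W 0 = ∅)
    (hstep : ∀ j < k, W (j + 1) = insert (c (j + 1)) (W j))
    (hnew : ∀ j < k, c (j + 1) ∉ W j)
    (hmax : ∀ j < k, ∀ c' : C, c' ∉ W j →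
      (cov A (insert (c (j + 1)) (W j)) : ℝ) - cov A (W j) ≥
        ((cov A (insert c' (W j)) : ℝ) - cov A (W j)) - ε)
    (O : Finset C) (hO : O.card = k) :
    (cov A (W k) : ℝ) ≥ ((cov A O : ℝ) - ε * k) * (1 - (1 - 1 / k) ^ k) ∧
    ((cov A O : ℝ) ≥ ε * k →
      (cov A (W k) : ℝ) ≥ ((cov A O : ℝ) - ε * k) * (1 - (Real.exp 1)⁻¹)) := by
  have hk0 : (0 : ℝ) < k := by exact_mod_cast hk
  have hr : (0 : ℝ) ≤ 1 - 1 / k := by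
    rw [sub_nonneg, div_le_one hk0]
    exact_mod_cast hk
  have hrec : ∀ j < k, (cov A O : ℝ) - ε * k - cov A (W (j + 1)) ≤
      (1 - 1 / k) * ((cov A O : ℝ) - ε * k - cov A (W j)) := by
    intro j hj
    have hgain : ∀ x ∈ O, (cov A (insert x (W j)) : ℝ) - cov A (W j) ≤
        (cov A (W (j + 1)) : ℝ) - cov A (W j) + ε := by
      intro x _
      rw [hstep j hj]
      by_cases hx : x ∈ W j
      · have hmono : (cov A (W j) : ℝ) ≤ cov A (insert (c (j + 1)) (W j)) := by
          exact_mod_cast cov_mono A (subset_insert _ _)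
        rw [insert_eq_of_mem hx]
        linarith
      · linarith [hmax j hj x hx]
    have hsum := (cov_le_cov_add_sum_gain A (W j) O).trans
      (add_le_add_right (sum_le_card_nsmul O _ _ hgain) _)
    rw [hO, nsmul_eq_mul] at hsum
    have hdiv : ((cov A O : ℝ) - ε * k - cov A (W j)) / k ≤
        (cov A (W (j + 1)) : ℝ) - cov A (W j) := by
      rw [div_le_iff₀ hk0]
      linarith
    calc _ ≤ ((cov A O : ℝ) - ε * k - cov A (W j)) -
          ((cov A O : ℝ) - ε * k - cov A (W j)) / k := by linarith
      _ = _ := by ring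
  have hpow : ∀ j ≤ k, (cov A O : ℝ) - ε * k - cov A (W j) ≤
      (1 - 1 / k) ^ j * ((cov A O : ℝ) - ε * k) := by
    intro j
    induction j with
    | zero => simp [hW0, cov]
    | succ j ih =>
      intro hj
      calc _ ≤ _ := hrec j hj
        _ ≤ _ := mul_le_mul_of_nonneg_left (ih (Nat.le_of_succ_le hj)) hr
        _ = _ := by ring
  have hmain : (cov A (W k) : ℝ) ≥ ((cov A O : ℝ) - ε * k) * (1 - (1 - 1 / k) ^ k) := by
    linarith [hpow k le_rfl]
  refine ⟨hmain, fun hopt => ge_trans hmain (mul_le_mul_of_nonneg_left ?_ (sub_nonneg.2 hopt))⟩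
  have hexp : (1 - 1 / (k : ℝ)) ^ k ≤ (Real.exp 1)⁻¹ := by
    rw [← Real.exp_neg]
    exact Real.one_sub_div_pow_le_exp_neg (by exact_mod_cast hk)
  linarith
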